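/- Let d be a positive integer and let Ω ⊆ ℝ^d be a locally compact set. Let ξ be any gauge and let ψ be a gauge with liminf_{r→0+} ψ(r)/r^{d-1} = 0. Then for a typical function f ∈ C(Ω) there are sets A ⊆ Ω and B ⊆ ℝ such that (i) ν^ψ(A) = 0, (ii) H^ξ(B) = 0, and (iii) the graph of f is contained in the cross product A ⋈ B = (A × ℝ) ∪ (ℝ^d × B). -/

import Mathlib

open Filter Set Topology MeasureTheory
open scoped ENNReal NNReal

noncomputable section

/-- A gauge: nondecreasing on `[0,∞)`, right-continuous, `φ 0 = 0`, positive on `(0,∞)`. -/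
def IsGauge (φ : ℝ → ℝ) : Prop :=
  (∀ ⦃a b : ℝ⦄, 0 ≤ a → a ≤ b → φ a ≤ φ b) ∧
  (∀ a : ℝ, 0 ≤ a → ContinuousWithinAt φ (Set.Ici a) a) ∧
  φ 0 = 0 ∧ (∀ r : ℝ, 0 < r → 0 < φ r)

/-- `N_δ(E)`: the least number of sets of diameter at most `δ` needed to cover `E`. -/
def coverNum {X : Type*} [PseudoMetricSpace X] (δ : ℝ) (E : Set X) : ℝ≥0∞ :=
  ⨅ (n : ℕ) (_ : ∃ F : Fin n → Set X,
    (∀ i, EMetric.diam (F i) ≤ ENNReal.ofReal δ) ∧ E ⊆ ⋃ i, F i), (n : ℝ≥0∞)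

/-- `ν_0^ζ(E) = liminf_{δ→0+} N_δ(E)·ζ(δ)`. -/
def nu0 {X : Type*} [PseudoMetricSpace X] (ζ : ℝ → ℝ) (E : Set X) : ℝ≥0∞ :=
  Filter.liminf (fun δ : ℝ => coverNum δ E * ENNReal.ofReal (ζ δ)) (𝓝[>] (0:ℝ))

/-- The lower box-counting measure `ν^ζ`. -/
def lowerBoxMeasure {X : Type*} [PseudoMetricSpace X] (ζ : ℝ → ℝ) (E : Set X) : ℝ≥0∞ :=
  ⨅ (G : ℕ → Set X) (_ : E ⊆ ⋃ n, G n), ∑' n, nu0 ζ (G n)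

/-- The lower box dimension `lbdim E = liminf_{r→0+} log N_r(E)/|log r|`. -/
def lbdim {X : Type*} [PseudoMetricSpace X] (E : Set X) : EReal :=
  Filter.liminf (fun r : ℝ => ENNReal.log (coverNum r E) * ((|Real.log r|⁻¹ : ℝ) : EReal))
    (𝓝[>] (0:ℝ))

/-- The lower packing dimension. -/
def lpdim {X : Type*} [PseudoMetricSpace X] (E : Set X) : EReal :=
  ⨅ (G : ℕ → Set X) (_ : E ⊆ ⋃ n, G n), ⨆ n, lbdim (G n)

/-- The generalized lower scaled oscillation `lip_φ f`. -/
def lipGauge {X : Type*} [PseudoMetricSpace X] (φ : ℝ → ℝ) (f : X → ℝ) (x : X) : ℝ≥0∞ :=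
  Filter.liminf
    (fun r : ℝ => EMetric.diam (f '' Metric.closedBall x r) / ENNReal.ofReal (φ r))
    (𝓝[>] (0:ℝ))

/-- The upper scaled oscillation `Lip f`. -/
def LipGauge {X : Type*} [PseudoMetricSpace X] (φ : ℝ → ℝ) (f : X → ℝ) (x : X) : ℝ≥0∞ :=
  Filter.limsup
    (fun r : ℝ => EMetric.diam (f '' Metric.closedBall x r) / ENNReal.ofReal (φ r))
    (𝓝[>] (0:ℝ))

/-- The Hausdorff measure with gauge `ξ`. -/
def hausdorffGauge {X : Type*} [PseudoMetricSpace X] (ξ : ℝ → ℝ) (E : Set X) : ℝ≥0∞ :=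
  ⨆ (δ : ℝ) (_ : 0 < δ), ⨅ (G : ℕ → Set X) (_ : E ⊆ ⋃ n, G n)
    (_ : ∀ n, EMetric.diam (G n) ≤ ENNReal.ofReal δ),
    ∑' n, ENNReal.ofReal (ξ (EMetric.diam (G n)).toReal)

/-- A box in `ℝ^k`. -/
def IsBox {k : ℕ} (S : Set (EuclideanSpace ℝ (Fin k))) : Prop :=
  ∃ a b : Fin k → ℝ, S = {x | ∀ i, x i ∈ Set.Icc (a i) (b i)}

/-- A microscopic subset of `ℝ^k`. -/
def Microscopic {k : ℕ} (X : Set (EuclideanSpace ℝ (Fin k))) : Prop :=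
  ∀ ε : ℝ, 0 < ε → ∃ B : ℕ → Set (EuclideanSpace ℝ (Fin k)),
    (∀ n, IsBox (B n)) ∧ X ⊆ ⋃ n, B n ∧
    ∀ n, MeasureTheory.volume (B n) ≤ ENNReal.ofReal (ε ^ (n + 1))

/-- A microscopic subset of `ℝ`. -/
def MicroscopicR (E : Set ℝ) : Prop :=
  ∀ ε : ℝ, 0 < ε → ∃ I : ℕ → ℝ × ℝ,
    E ⊆ ⋃ n, Set.Icc (I n).1 (I n).2 ∧
    ∀ n, MeasureTheory.volume (Set.Icc (I n).1 (I n).2) ≤ ENNReal.ofReal (ε ^ (n + 1))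

end

section CoverNumber

variable {X : Type*} [PseudoMetricSpace X]

lemma coverNum_mono {δ : ℝ} {E F : Set X} (h : E ⊆ F) : coverNum δ E ≤ coverNum δ F := by
  refine le_iInf₂ fun n ⟨V, hV, hF⟩ => ?_
  exact iInf₂_le_of_le n ⟨V, hV, h.trans hF⟩ le_rfl

/-- A finite coding of `E` whose fibres are `δ`-small bounds the covering number of `E`. -/
lemma coverNum_le_card_of_code {κ : Type*} {δ : ℝ} {E : Set X} (S : Finset κ) (code : X → κ)
    (hS : ∀ x ∈ E, code x ∈ S)
    (hcode : ∀ x ∈ E, ∀ y ∈ E, code x = code y → dist x y ≤ δ) :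
    coverNum δ E ≤ S.card := by
  refine iInf₂_le_of_le S.card ⟨fun i => {x ∈ E | code x = S.equivFin.symm i}, ?_, ?_⟩ le_rfl
  · refine fun i => Metric.ediam_le fun x hx y hy => ?_
    rw [edist_dist]
    exact ENNReal.ofReal_le_ofReal (hcode x hx.1 y hy.1 (hx.2.trans hy.2.symm))
  · intro x hx
    exact mem_iUnion.2 ⟨S.equivFin ⟨code x, hS x hx⟩, hx, by simp⟩

lemma nu0_eq_zero_of_seq {ζ : ℝ → ℝ} {E : Set X} {δ : ℕ → ℝ} {k : ℕ}
    (hδ0 : ∀ m, 0 < δ m) (hδ : ∀ m, δ m < 1 / ((m : ℝ) + 1))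
    (h : ∀ m, k ≤ m → coverNum (δ m) E * ENNReal.ofReal (ζ (δ m)) ≤
      ENNReal.ofReal (1 / ((m : ℝ) + 1))) :
    nu0 ζ E = 0 := by
  have hδ' : Tendsto δ atTop (𝓝[>] 0) :=
    tendsto_nhdsWithin_iff.2
      ⟨squeeze_zero (fun m => (hδ0 m).le) (fun m => (hδ m).le)
        tendsto_one_div_add_atTop_nhds_zero_nat, Eventually.of_forall hδ0⟩
  refine le_antisymm (le_of_forall_pos_le_add fun ε hε => ?_) zero_le
  rw [zero_add]
  have hlim : Tendsto (fun m : ℕ => ENNReal.ofReal (1 / ((m : ℝ) + 1))) atTop (𝓝 0) := by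
    simpa using ENNReal.tendsto_ofReal (tendsto_one_div_add_atTop_nhds_zero_nat (𝕜 := ℝ))
  refine liminf_le_of_frequently_le' (hδ'.frequently (Eventually.frequently ?_))
  filter_upwards [eventually_ge_atTop k, hlim.eventually_le_const hε] with m hm hm'
  exact (h m hm).trans hm'

lemma lowerBoxMeasure_iUnion_eq_zero {ζ : ℝ → ℝ} {A : ℕ → Set X} (h : ∀ k, nu0 ζ (A k) = 0) :
    lowerBoxMeasure ζ (⋃ k, A k) = 0 :=
  le_antisymm (iInf₂_le_of_le A subset_rfl (by simp [h])) zero_le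

end CoverNumber

section GaugeCover

variable {X : Type*} [PseudoMetricSpace X]

/-- `B` has a countable cover by sets of diameter at most `δ` and total `ξ`-cost at most `ε`. -/
def HasGaugeCover (ξ : ℝ → ℝ) (δ : ℝ) (ε : ℝ≥0∞) (B : Set X) : Prop :=
  ∃ V : ℕ → Set X, B ⊆ ⋃ n, V n ∧ (∀ n, Metric.ediam (V n) ≤ ENNReal.ofReal δ) ∧
    ∑' n, ENNReal.ofReal (ξ (Metric.ediam (V n)).toReal) ≤ ε

lemma HasGaugeCover.of_encodable {ι : Type*} [Encodable ι] {ξ : ℝ → ℝ} (hξ : ξ 0 = 0) {δ : ℝ}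
    {ε : ℝ≥0∞} {B : Set X} (V : ι → Set X) (hB : B ⊆ ⋃ i, V i)
    (hV : ∀ i, Metric.ediam (V i) ≤ ENNReal.ofReal δ)
    (hε : ∑' i, ENNReal.ofReal (ξ (Metric.ediam (V i)).toReal) ≤ ε) :
    HasGaugeCover ξ δ ε B := by
  refine ⟨fun n => ⋃ b ∈ Encodable.decode₂ ι n, V b, ?_, fun n => ?_, ?_⟩
  · rwa [Encodable.iUnion_decode₂]
  · exact Encodable.iUnion_decode₂_cases (C := fun s => Metric.ediam s ≤ ENNReal.ofReal δ)
      (by simp) hV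
  · rwa [tsum_iUnion_decode₂ (fun s => ENNReal.ofReal (ξ (Metric.ediam s).toReal)) (by simp [hξ])]

lemma HasGaugeCover.mono {ξ : ℝ → ℝ} {δ : ℝ} {ε : ℝ≥0∞} {B C : Set X}
    (hC : HasGaugeCover ξ δ ε C) (h : B ⊆ C) : HasGaugeCover ξ δ ε B := by
  obtain ⟨V, hV, hV'⟩ := hC
  exact ⟨V, h.trans hV, hV'⟩

lemma hausdorffGauge_eq_zero {ξ : ℝ → ℝ} {B : Set X}
    (h : ∀ δ : ℝ, 0 < δ → ∀ ε : ℝ≥0∞, 0 < ε → HasGaugeCover ξ δ ε B) :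
    hausdorffGauge ξ B = 0 := by
  refine le_antisymm (iSup₂_le fun δ hδ => le_of_forall_pos_le_add fun ε hε => ?_) zero_le
  obtain ⟨V, hB, hV, hε'⟩ := h δ hδ ε hε
  rw [zero_add]
  exact iInf₂_le_of_le V hB (iInf_le_of_le hV hε')

/-- Borel–Cantelli for gauge covers. -/
lemma hausdorffGauge_limsup_eq_zero {ξ : ℝ → ℝ} (hξ : ξ 0 = 0) {C : ℕ → Set X}
    (h : ∀ m, HasGaugeCover ξ ((1 / 2) ^ m) ((1 / 2) ^ m) (C m)) :
    hausdorffGauge ξ (⋂ k, ⋃ m ≥ k, C m) = 0 := by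
  choose V hC hV hε using h
  refine hausdorffGauge_eq_zero fun δ hδ ε hε0 => ?_
  have h1 : ∀ᶠ k : ℕ in atTop, ((1 / 2 : ℝ)) ^ k < δ :=
    (tendsto_pow_atTop_nhds_zero_of_lt_one (by norm_num) (by norm_num)).eventually_lt_const hδ
  have h2 : ∀ᶠ k : ℕ in atTop, ((1 / 2 : ℝ≥0∞)) ^ k * 2 < ε := by
    have : Tendsto (fun k : ℕ => (1 / 2 : ℝ≥0∞) ^ k * 2) atTop (𝓝 (0 * 2)) :=
      ENNReal.Tendsto.mul_const
        (ENNReal.tendsto_pow_atTop_nhds_zero_of_lt_one (by simp)) (by simp)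
    rw [zero_mul] at this
    exact this.eventually_lt_const hε0
  obtain ⟨k, hk1, hk2⟩ := (h1.and h2).exists
  refine HasGaugeCover.of_encodable hξ (fun p : ℕ × ℕ => V (k + p.1) p.2) ?_ ?_ ?_
  · intro x hx
    obtain ⟨m, hm, hxm⟩ := mem_iUnion₂.1 (mem_iInter.1 hx k)
    obtain ⟨n, hn⟩ := mem_iUnion.1 (hC m hxm)
    refine mem_iUnion.2 ⟨(m - k, n), ?_⟩
    simpa [Nat.add_sub_cancel' hm] using hn
  · rintro ⟨j, n⟩
    refine (hV _ _).trans (ENNReal.ofReal_le_ofReal (le_trans ?_ hk1.le))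
    exact pow_le_pow_of_le_one (by norm_num) (by norm_num) (Nat.le_add_right k j)
  · rw [ENNReal.tsum_prod']
    calc ∑' (j : ℕ) (n : ℕ), ENNReal.ofReal (ξ (Metric.ediam (V (k + j) n)).toReal)
        ≤ ∑' j : ℕ, (1 / 2 : ℝ≥0∞) ^ (k + j) := ENNReal.tsum_le_tsum fun j => hε (k + j)
      _ = (1 / 2 : ℝ≥0∞) ^ k * 2 := by
          simp_rw [pow_add]
          rw [ENNReal.tsum_mul_left, ENNReal.tsum_geometric]
          simp
      _ ≤ ε := hk2.le

end GaugeCover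

lemma IsGauge.exists_le {ξ : ℝ → ℝ} (hξ : IsGauge ξ) {ε : ℝ} (hε : 0 < ε) :
    ∃ η > 0, ξ η ≤ ε := by
  have h : Tendsto ξ (𝓝[>] 0) (𝓝 0) := by
    have h0 := (hξ.2.1 0 le_rfl).mono_left (nhdsWithin_mono 0 Ioi_subset_Ici_self)
    rwa [hξ.2.2.1] at h0
  obtain ⟨η, h1, h2⟩ := ((h.eventually_le_const hε).and self_mem_nhdsWithin).exists
  exact ⟨η, h2, h1⟩

/-- The points uniformly close to a finite set of reals have arbitrarily cheap gauge covers. -/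
lemma exists_hasGaugeCover_thickening {ξ : ℝ → ℝ} (hξ : IsGauge ξ) {S : Set ℝ} (hS : S.Finite)
    {δ : ℝ} (hδ : 0 < δ) {ε : ℝ≥0∞} (hε : 0 < ε) :
    ∃ η > 0, HasGaugeCover ξ δ ε (Metric.thickening η S) := by
  have : Fintype S := hS.fintype
  have : Encodable S := Fintype.toEncodable S
  obtain ⟨e, he0, he⟩ : ∃ e : ℝ, 0 < e ∧ (Fintype.card S : ℝ≥0∞) * ENNReal.ofReal e ≤ ε := by
    obtain ⟨e, he0, he⟩ := ENNReal.exists_nnreal_pos_mul_lt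
      (ENNReal.natCast_ne_top (Fintype.card S)) hε.ne'
    refine ⟨e, he0, ?_⟩
    rw [ENNReal.ofReal_coe_nnreal, mul_comm]
    exact he.le
  obtain ⟨r, hr0, hr⟩ := hξ.exists_le he0
  have hη : 0 < min r δ / 2 := by positivity
  have hdiam : ∀ v : ℝ, Metric.ediam (Metric.ball v (min r δ / 2)) ≤ ENNReal.ofReal (min r δ) := by
    intro v
    rw [Real.ball_eq_Ioo, Real.ediam_Ioo]
    exact ENNReal.ofReal_le_ofReal (by linarith)
  refine ⟨min r δ / 2, hη, HasGaugeCover.of_encodable hξ.2.2.1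
    (fun v : S => Metric.ball (v : ℝ) (min r δ / 2)) ?_ (fun v => ?_) ?_⟩
  · rw [Metric.thickening_eq_biUnion_ball, biUnion_eq_iUnion]
  · exact (hdiam v).trans (ENNReal.ofReal_le_ofReal (min_le_right _ _))
  · refine le_trans (ENNReal.tsum_le_tsum (g := fun _ => ENNReal.ofReal e) fun v => ?_) ?_
    · refine ENNReal.ofReal_le_ofReal ((hξ.1 ENNReal.toReal_nonneg ?_).trans hr)
      exact ENNReal.toReal_le_of_le_ofReal hr0.le
        ((hdiam v).trans (ENNReal.ofReal_le_ofReal (min_le_left _ _)))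
    · rw [tsum_fintype]
      simpa using he

section Staircase

/-- A continuous map of the line, equal to the integer part except where the fractional part
exceeds `1 - τ`. -/
noncomputable def staircase (τ u : ℝ) : ℝ := ⌊u⌋ + max 0 (1 - (1 - Int.fract u) / τ)

lemma continuous_staircase (τ : ℝ) (hτ0 : 0 < τ) (hτ1 : τ ≤ 1) : Continuous (staircase τ) := by
  have h : Continuous ((fun v : ℝ => max 0 (1 - (1 - v) / τ) - v) ∘ Int.fract) := by
    refine ContinuousOn.comp_fract'' (by fun_prop) ?_
    have : 1 - 1 / τ ≤ 0 := by
      rw [sub_nonpos, le_div_iff₀ hτ0]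
      linarith
    simp only [sub_zero, sub_self, zero_div]
    rw [max_eq_left this]
    norm_num
  convert continuous_id.add h using 1
  ext u
  have := Int.floor_add_fract u
  simp only [staircase, Pi.add_apply, id, Function.comp]
  linarith

lemma abs_staircase_sub_le {τ : ℝ} (hτ0 : 0 < τ) (u : ℝ) : |staircase τ u - u| ≤ 1 := by
  have h := Int.floor_add_fract u
  have h0 := Int.fract_nonneg u
  have h1 := Int.fract_lt_one u
  have h2 : max 0 (1 - (1 - Int.fract u) / τ) ≤ 1 :=
    max_le zero_le_one (by linarith [div_nonneg (sub_nonneg.2 h1.le) hτ0.le])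
  have h3 : 0 ≤ max 0 (1 - (1 - Int.fract u) / τ) := le_max_left _ _
  rw [staircase, abs_le]
  constructor <;> linarith

lemma staircase_eq_floor {τ u : ℝ} (hτ0 : 0 < τ) (hu : Int.fract u ≤ 1 - τ) :
    staircase τ u = ⌊u⌋ := by
  have : 1 - (1 - Int.fract u) / τ ≤ 0 := by
    rw [sub_nonpos, le_div_iff₀ hτ0]
    linarith
  rw [staircase, max_eq_left this, add_zero]

end Staircase

section Grid

lemma abs_sub_lt_of_floor_eq {c t t' : ℝ} (hc : 0 < c) (h : ⌊t / c⌋ = ⌊t' / c⌋) :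
    |t - t'| < c := by
  have := Int.abs_sub_lt_one_of_floor_eq_floor h
  rwa [← sub_div, abs_div, abs_of_pos hc, div_lt_one hc] at this

lemma floor_mem_Icc {R c t : ℝ} {L : ℤ} (hc : 0 < c) (ht : |t| ≤ R) (hL : R / c ≤ L) :
    ⌊t / c⌋ ∈ Finset.Icc (-L) L := by
  have h := abs_le.1 ht
  have h1 : t / c ≤ L := (div_le_div_of_nonneg_right h.2 hc.le).trans hL
  have h2 : -(L : ℝ) ≤ t / c := by
    have := div_le_div_of_nonneg_right h.1 hc.le
    rw [neg_div] at this
    linarith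
  rw [Finset.mem_Icc]
  exact ⟨Int.le_floor.2 (by push_cast; exact h2), Int.cast_le.1 ((Int.floor_le _).trans h1)⟩

lemma EuclideanSpace.dist_le_card_mul {d : ℕ} {c : ℝ} (hc : 0 ≤ c) {x y : EuclideanSpace ℝ (Fin d)}
    (h : ∀ i, |x i - y i| ≤ c) : dist x y ≤ d * c := by
  rw [EuclideanSpace.dist_eq]
  refine Real.sqrt_le_iff.2 ⟨by positivity, ?_⟩
  calc ∑ i, dist (x i) (y i) ^ 2 ≤ ∑ _i : Fin d, c ^ 2 := by
        refine Finset.sum_le_sum fun i _ => ?_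
        rw [Real.dist_eq]
        exact pow_le_pow_left₀ (abs_nonneg _) (h i) 2
    _ = d * c ^ 2 := by simp
    _ ≤ (d * c) ^ 2 := by
        rw [mul_pow]
        refine mul_le_mul_of_nonneg_right ?_ (sq_nonneg c)
        exact_mod_cast Nat.le_self_pow two_ne_zero d

/-- The part of the cube of half-side `R` lying in slabs of relative width `τ` below the grid
hyperplanes of mesh `s`. -/
def gridSlabs (d : ℕ) (R s τ : ℝ) : Set (EuclideanSpace ℝ (Fin d)) :=
  {x | (∀ i, |x i| ≤ R) ∧ ∃ i, 1 - τ < Int.fract (x i / s)}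

lemma coverNum_gridSlabs_le (n : ℕ) {R s δ : ℝ} (hR : 0 ≤ R) (hs : 0 < s) (hδ : 0 < δ)
    (hδ1 : δ ≤ 1) :
    coverNum δ (gridSlabs (n + 1) R s (δ / (n + 1) / s)) ≤
      ENNReal.ofReal ((n + 1) * (2 * ⌈R / s⌉ + 1) * (2 * (R * (n + 1)) + 3) ^ n / δ ^ n) := by
  classical
  set c : ℝ := δ / (n + 1) with hc
  have hc0 : 0 < c := by positivity
  set L : ℤ := ⌈R / s⌉ with hL
  set M : ℤ := ⌈R / c⌉ with hM
  have hL0 : 0 ≤ L := Int.ceil_nonneg (by positivity)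
  have hM0 : 0 ≤ M := Int.ceil_nonneg (by positivity)
  let i₀ : EuclideanSpace ℝ (Fin (n + 1)) → Fin (n + 1) := fun x =>
    if h : ∃ i, 1 - c / s < Int.fract (x i / s) then h.choose else 0
  have hi₀ : ∀ x ∈ gridSlabs (n + 1) R s (c / s), 1 - c / s < Int.fract (x (i₀ x) / s) := by
    intro x hx
    simp only [i₀, dif_pos hx.2]
    exact hx.2.choose_spec
  let code : EuclideanSpace ℝ (Fin (n + 1)) → Fin (n + 1) × ℤ × (Fin n → ℤ) := fun x =>
    (i₀ x, ⌊x (i₀ x) / s⌋, fun j => ⌊x ((i₀ x).succAbove j) / c⌋)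
  let S : Finset (Fin (n + 1) × ℤ × (Fin n → ℤ)) :=
    Finset.univ ×ˢ Finset.Icc (-L) L ×ˢ Fintype.piFinset fun _ => Finset.Icc (-M) M
  refine (coverNum_le_card_of_code S code ?_ ?_).trans ?_
  · intro x hx
    simp only [S, code, Finset.mem_product, Finset.mem_univ, true_and, Fintype.mem_piFinset]
    exact ⟨floor_mem_Icc hs (hx.1 _) (Int.le_ceil _),
      fun j => floor_mem_Icc hc0 (hx.1 _) (Int.le_ceil _)⟩
  · intro x hx y hy hxy
    simp only [code, Prod.mk.injEq] at hxy
    obtain ⟨hi, hk, hj⟩ := hxy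
    have hxi := hi₀ x hx
    have hyi := hi₀ y hy
    rw [← hi] at hk hj hyi
    have hd : dist x y ≤ ((n + 1 : ℕ) : ℝ) * c := by
      refine EuclideanSpace.dist_le_card_mul hc0.le fun i => ?_
      rcases Fin.eq_self_or_eq_succAbove (i₀ x) i with rfl | ⟨j, rfl⟩
      · have hx1 := Int.fract_lt_one (x (i₀ x) / s)
        have hy1 := Int.fract_lt_one (y (i₀ x) / s)
        have hx2 := Int.floor_add_fract (x (i₀ x) / s)
        have hy2 := Int.floor_add_fract (y (i₀ x) / s)
        rw [hk] at hx2
        have : |x (i₀ x) / s - y (i₀ x) / s| ≤ c / s := by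
          rw [abs_le]
          constructor <;> linarith
        rwa [← sub_div, abs_div, abs_of_pos hs, div_le_div_iff_of_pos_right hs] at this
      · exact (abs_sub_lt_of_floor_eq hc0 (congrFun hj j)).le
    refine hd.trans_eq ?_
    rw [hc]
    push_cast
    field_simp
  · have hcard : (S.card : ℝ) = (n + 1) * (2 * L + 1) * (2 * M + 1) ^ n := by
      have h1 : ∀ K : ℤ, 0 ≤ K → (((Finset.Icc (-K) K).card : ℕ) : ℝ) = 2 * K + 1 := by
        intro K hK
        have : (((Finset.Icc (-K) K).card : ℕ) : ℤ) = 2 * K + 1 := by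
          rw [Int.card_Icc, Int.toNat_of_nonneg (by linarith)]
          ring
        exact_mod_cast this
      simp only [S, Finset.card_product, Finset.card_univ, Fintype.card_fin,
        Fintype.card_piFinset, Finset.prod_const]
      push_cast
      rw [h1 L hL0, h1 M hM0]
      ring
    rw [← ENNReal.ofReal_natCast, hcard]
    refine ENNReal.ofReal_le_ofReal ?_
    have hM1 : 2 * (M : ℝ) + 1 ≤ (2 * (R * (n + 1)) + 3) / δ := by
      have h1 : (M : ℝ) < R / c + 1 := Int.ceil_lt_add_one _
      have h2 : R / c = R * (n + 1) / δ := by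
        rw [hc]
        field_simp
      have h3 : (3 : ℝ) ≤ 3 / δ := by
        rw [le_div_iff₀ hδ]
        linarith
      rw [add_div, mul_div_assoc]
      linarith
    have hL' : (0 : ℝ) ≤ L := by exact_mod_cast hL0
    have hM' : (0 : ℝ) ≤ M := by exact_mod_cast hM0
    rw [mul_div_assoc, ← div_pow]
    gcongr

/-- Suitable slab widths make the grid slabs `ψ`-cheap at some scale. -/
lemma exists_coverNum_gridSlabs_mul_le (n : ℕ) {ψ : ℝ → ℝ}
    (hψd : ∀ ε : ℝ, 0 < ε → ∃ᶠ r in 𝓝[>] (0 : ℝ), ψ r / r ^ n < ε)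
    {R s ε : ℝ} (hR : 0 ≤ R) (hs : 0 < s) (hε : 0 < ε) :
    ∃ δ τ : ℝ, 0 < δ ∧ δ < ε ∧ 0 < τ ∧ τ ≤ 1 ∧
      coverNum δ (gridSlabs (n + 1) R s τ) * ENNReal.ofReal (ψ δ) ≤ ENNReal.ofReal ε := by
  set C : ℝ := (n + 1) * (2 * ⌈R / s⌉ + 1) * (2 * (R * (n + 1)) + 3) ^ n with hC
  have hC0 : 0 < C := by
    have : (0 : ℝ) ≤ ⌈R / s⌉ := by exact_mod_cast Int.ceil_nonneg (by positivity)
    positivity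
  have hev : ∀ᶠ r : ℝ in 𝓝[>] (0 : ℝ), r ∈ Ioo 0 (min (min 1 ε) s) :=
    Ioo_mem_nhdsGT (by positivity)
  obtain ⟨δ, hψδ, hδ0, hδ⟩ := ((hψd (ε / C) (by positivity)).and_eventually hev).exists
  have hδ1 : δ < 1 := hδ.trans_le ((min_le_left _ _).trans (min_le_left _ _))
  have hδε : δ < ε := hδ.trans_le ((min_le_left _ _).trans (min_le_right _ _))
  have hδs : δ < s := hδ.trans_le (min_le_right _ _)
  refine ⟨δ, δ / (n + 1) / s, hδ0, hδε, by positivity, ?_, ?_⟩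
  · rw [div_div, div_le_one (by positivity)]
    have : (0 : ℝ) ≤ n := n.cast_nonneg
    nlinarith
  · refine (mul_le_mul_left (coverNum_gridSlabs_le n hR hs hδ0 hδ1.le) _).trans ?_
    rw [← ENNReal.ofReal_mul (by positivity)]
    refine ENNReal.ofReal_le_ofReal ?_
    rw [lt_div_iff₀ hC0] at hψδ
    calc C / δ ^ n * ψ δ = ψ δ / δ ^ n * C := by ring
      _ ≤ ε := hψδ.le

end Grid

lemma ContinuousMap.hasBasis_nhds_dist {X : Type*} [TopologicalSpace X] (f : C(X, ℝ)) :
    (𝓝 f).HasBasis (fun p : Set X × ℝ => IsCompact p.1 ∧ 0 < p.2)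
      fun p => {g | ∀ x ∈ p.1, dist (f x) (g x) < p.2} :=
  nhds_basis_uniformity' (Metric.uniformity_basis_dist.compactConvergenceUniformity)

/-- A continuous function on a subset of `ℝ^d` is approximated, on a compact set, by continuous
functions taking finitely many values outside thin grid slabs. -/
lemma exists_dist_lt_finite_image_diff_gridSlabs {d : ℕ} {Ω : Set (EuclideanSpace ℝ (Fin d))}
    (g : C(Ω, ℝ)) {K : Set Ω} (hK : IsCompact K) {ε : ℝ} (hε : 0 < ε) :
    ∃ R s : ℝ, 0 ≤ R ∧ 0 < s ∧
      ∀ τ : ℝ, 0 < τ → τ ≤ 1 → ∃ h : C(Ω, ℝ), (∀ x ∈ K, dist (g x) (h x) < ε) ∧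
        (h '' {x ∈ K | x.1 ∉ gridSlabs d R s τ}).Finite := by
  have hcomp : CompactSpace K := isCompact_iff_compactSpace.1 hK
  have hval : IsCompact ((↑) '' K : Set (EuclideanSpace ℝ (Fin d))) :=
    hK.image continuous_subtype_val
  obtain ⟨R, hR0, hR⟩ : ∃ R : ℝ, 0 ≤ R ∧ ∀ x ∈ K, ∀ i, |x.1 i| ≤ R := by
    obtain ⟨R, hR0, hR⟩ := hval.isBounded.exists_pos_norm_le
    exact ⟨R, hR0.le, fun x hx i =>
      (PiLp.norm_apply_le x.1 i).trans (hR x.1 (mem_image_of_mem _ hx))⟩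
  have hemb : IsClosedEmbedding fun x : K => (x.1.1 : EuclideanSpace ℝ (Fin d)) :=
    Continuous.isClosedEmbedding (by fun_prop)
      (Subtype.val_injective.comp Subtype.val_injective)
  obtain ⟨G, hG⟩ := ContinuousMap.exists_extension hemb (g.restrict K)
  have hGg : ∀ x ∈ K, G x.1 = g x := fun x hx => DFunLike.congr_fun hG (⟨x, hx⟩ : K)
  obtain ⟨ρ, hρ, hGρ⟩ := Metric.mem_uniformity_dist.1
    (hval.uniformContinuousAt_of_continuousAt G (fun a _ => G.continuous.continuousAt)
      (Metric.dist_mem_uniformity hε))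
  have hs : 0 < ρ / (d + 1) := by positivity
  set s : ℝ := ρ / (d + 1) with hsdef
  refine ⟨R, s, hR0, hs, fun τ hτ0 hτ1 => ?_⟩
  have hst := continuous_staircase τ hτ0 hτ1
  let q : EuclideanSpace ℝ (Fin d) → EuclideanSpace ℝ (Fin d) := fun x =>
    WithLp.toLp 2 fun i => s * staircase τ (x i / s)
  have hq : Continuous q := by
    refine (PiLp.continuous_toLp 2 _).comp (continuous_pi fun i => ?_)
    exact continuous_const.mul (hst.comp (by fun_prop))
  refine ⟨⟨fun x => G (q x.1), G.continuous.comp (hq.comp continuous_subtype_val)⟩, ?_, ?_⟩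
  · intro x hx
    have hdist : dist x.1 (q x.1) < ρ := by
      refine (EuclideanSpace.dist_le_card_mul (c := s) hs.le fun i => ?_).trans_lt ?_
      · have h1 : x.1 i - q x.1 i = -(s * (staircase τ (x.1 i / s) - x.1 i / s)) := by
          simp only [q]
          field_simp
          ring
        rw [h1, abs_neg, abs_mul, abs_of_pos hs]
        exact mul_le_of_le_one_right hs.le (abs_staircase_sub_le hτ0 _)
      · rw [hsdef, ← mul_div_assoc, div_lt_iff₀ (by positivity)]
        nlinarith
    rw [← hGg x hx]
    exact hGρ hdist (mem_image_of_mem _ hx)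
  · let F : (Fin d → ℤ) → ℝ := fun k => G (WithLp.toLp 2 fun i => s * (k i : ℝ))
    refine ((Fintype.piFinset fun _ : Fin d =>
      Finset.Icc (-⌈R / s⌉) ⌈R / s⌉).finite_toSet.image F).subset ?_
    rintro _ ⟨x, ⟨hxK, hx⟩, rfl⟩
    refine ⟨fun i => ⌊x.1 i / s⌋, ?_, ?_⟩
    · rw [Finset.mem_coe, Fintype.mem_piFinset]
      exact fun i => floor_mem_Icc hs (hR x hxK i) (Int.le_ceil _)
    · have hfract : ∀ i, Int.fract (x.1 i / s) ≤ 1 - τ := by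
        intro i
        by_contra! hi
        exact hx ⟨hR x hxK, i, hi⟩
      simp only [F, q, ContinuousMap.coe_mk, staircase_eq_floor hτ0 (hfract _)]

/-- The functions whose restriction to `K`, outside a set that is `ψ`-cheap at some scale below
`ε`, has an image with a cheap `ξ`-cover. -/
def cheapFunctions {d : ℕ} {Ω : Set (EuclideanSpace ℝ (Fin d))} (ξ ψ : ℝ → ℝ) (K : Set Ω)
    (ε δ : ℝ) (e : ℝ≥0∞) : Set C(Ω, ℝ) :=
  {f | ∃ (E : Set (EuclideanSpace ℝ (Fin d))) (r : ℝ), 0 < r ∧ r < ε ∧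
    coverNum r E * ENNReal.ofReal (ψ r) ≤ ENNReal.ofReal ε ∧
    HasGaugeCover ξ δ e (f '' {x ∈ K | x.1 ∉ E})}

lemma cheapFunctions_mem_residual {n : ℕ} {Ω : Set (EuclideanSpace ℝ (Fin (n + 1)))}
    {ξ ψ : ℝ → ℝ} (hξ : IsGauge ξ)
    (hψd : ∀ ε : ℝ, 0 < ε → ∃ᶠ r in 𝓝[>] (0 : ℝ), ψ r / r ^ n < ε)
    {K : Set Ω} (hK : IsCompact K) {ε δ : ℝ} (hε : 0 < ε) (hδ : 0 < δ) {e : ℝ≥0∞} (he : 0 < e) :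
    cheapFunctions ξ ψ K ε δ e ∈ residual C(Ω, ℝ) := by
  refine mem_of_superset (residual_of_dense_open isOpen_interior fun g => ?_) interior_subset
  refine (mem_closure_iff_nhds_basis (ContinuousMap.hasBasis_nhds_dist g)).2 ?_
  rintro ⟨K', ε'⟩ ⟨hK', hε'⟩
  obtain ⟨R, s, hR, hs, hfin⟩ :=
    exists_dist_lt_finite_image_diff_gridSlabs g (hK'.union hK) hε'
  obtain ⟨r, τ, hr0, hr, hτ0, hτ1, hcover⟩ :=
    exists_coverNum_gridSlabs_mul_le n hψd hR hs hε
  obtain ⟨h, hgh, hh⟩ := hfin τ hτ0 hτ1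
  refine ⟨h, ?_, fun x hx => hgh x (Or.inl hx)⟩
  obtain ⟨η, hη, hηcover⟩ := exists_hasGaugeCover_thickening hξ hh hδ he
  rw [mem_interior_iff_mem_nhds]
  refine mem_of_superset ((ContinuousMap.hasBasis_nhds_dist h).mem_of_mem
    (i := (K, η)) ⟨hK, hη⟩) fun f hf => ?_
  refine ⟨gridSlabs (n + 1) R s τ, r, hr0, hr, hcover, hηcover.mono ?_⟩
  rintro _ ⟨x, ⟨hxK, hx⟩, rfl⟩
  rw [Metric.mem_thickening_iff]
  exact ⟨h x, ⟨x, ⟨Or.inr hxK, hx⟩, rfl⟩, by rw [dist_comm]; exact hf x hxK⟩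

theorem stmt8
    (d : ℕ) (hd : 0 < d) (Ω : Set (EuclideanSpace ℝ (Fin d)))
    (hΩ : LocallyCompactSpace Ω)
    (ξ ψ : ℝ → ℝ) (hξ : IsGauge ξ) (hψ : IsGauge ψ)
    (hψd : ∀ ε : ℝ, 0 < ε → ∃ᶠ r in 𝓝[>] (0:ℝ), ψ r / r ^ (d - 1) < ε) :
    ∀ᶠ f : C(↥Ω, ℝ) in residual C(↥Ω, ℝ),
      ∃ (A : Set (EuclideanSpace ℝ (Fin d))) (B : Set ℝ), A ⊆ Ω ∧
        lowerBoxMeasure ψ A = 0 ∧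
        hausdorffGauge ξ B = 0 ∧
        {p : EuclideanSpace ℝ (Fin d) × ℝ | ∃ hx : p.1 ∈ Ω, p.2 = f ⟨p.1, hx⟩}
          ⊆ (A ×ˢ (Set.univ : Set ℝ)) ∪ ((Set.univ : Set (EuclideanSpace ℝ (Fin d))) ×ˢ B) := by
  obtain ⟨n, rfl⟩ : ∃ n, d = n + 1 := ⟨d - 1, by omega⟩
  let K : CompactExhaustion Ω := CompactExhaustion.choice Ω
  have hres : ∀ᶠ f : C(Ω, ℝ) in residual C(Ω, ℝ), ∀ m : ℕ,
      f ∈ cheapFunctions ξ ψ (K m) (1 / ((m : ℝ) + 1)) ((1 / 2) ^ m) ((1 / 2) ^ m) :=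
    eventually_countable_forall.2 fun m => cheapFunctions_mem_residual hξ hψd (K.isCompact m)
      (by positivity) (by positivity) (ENNReal.pow_pos (by simp) m)
  filter_upwards [hres] with f hf
  choose E δ hδ0 hδ hE hcover using hf
  let A : ℕ → Set (EuclideanSpace ℝ (Fin (n + 1))) := fun k => Ω ∩ ⋂ m ≥ k, E m
  let C : ℕ → Set ℝ := fun m => f '' {x ∈ K m | x.1 ∉ E m}
  refine ⟨⋃ k, A k, ⋂ k, ⋃ m ≥ k, C m, iUnion_subset fun k => inter_subset_left, ?_,
    hausdorffGauge_limsup_eq_zero hξ.2.2.1 hcover, ?_⟩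
  · refine lowerBoxMeasure_iUnion_eq_zero fun k => nu0_eq_zero_of_seq hδ0 hδ (k := k) fun m hm => ?_
    refine (mul_le_mul_left (coverNum_mono ?_) _).trans (hE m)
    exact inter_subset_right.trans (iInter₂_subset m hm)
  · rintro ⟨x, y⟩ ⟨hx, hy⟩
    by_cases hxA : x ∈ ⋃ k, A k
    · exact Or.inl ⟨hxA, mem_univ _⟩
    refine Or.inr ⟨mem_univ _, mem_iInter.2 fun k => ?_⟩
    obtain ⟨j, hj⟩ := K.exists_mem ⟨x, hx⟩
    have hxk : x ∉ A (max j k) := fun h => hxA (mem_iUnion.2 ⟨_, h⟩)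
    simp only [A, mem_inter_iff, mem_iInter, not_and, not_forall] at hxk
    obtain ⟨m, hm, hxm⟩ := hxk hx
    refine mem_iUnion₂.2 ⟨m, (le_max_right j k).trans hm, ⟨x, hx⟩, ⟨?_, hxm⟩, hy.symm⟩
    exact K.subset ((le_max_left j k).trans hm) hj
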